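/- arXiv:1212.5756 — 3 statements merged into one kernel-verified Lean document; each statement's English description precedes it below -/
import Mathlib

section
/- Let A be a *-algebra over ℂ. (i) If A is essential and T : A → A is adjointable with T ∘ S = 0 for every adjointable S : A → A, then T = 0 (the multiplier algebra M(A) of an essential *-algebra is essential). (ii) If A is semiprime and T : A → A is adjointable with T ∘ S ∘ T = 0 for every adjointable S : A → A, then T = 0 (the multiplier algebra of a semiprime *-algebra is semiprime). -/
/-- An adjointable map on an essential `*`-ring is a right-module map. -/
theorem map_mul_of_adjointable {A : Type*} [NonUnitalRing A] [StarRing A]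
    (hA : ∀ a : A, (∀ b : A, a * b = 0) → a = 0) {T T' : A → A}
    (hT : ∀ x y : A, star (T x) * y = star x * T' y) (x y : A) :
    T (x * y) = T x * y := by
  refine star_injective (sub_eq_zero.mp (hA _ fun z => ?_))
  rw [sub_mul, hT, star_mul, star_mul, mul_assoc, mul_assoc, hT, sub_self]

/-- Let `A` be a `*`-algebra over `ℂ`.
(i)  If `A` is essential (`a * A = 0 → a = 0`) and `T : A → A` is adjointable with
     `T ∘ S = 0` for every adjointable `S : A → A`, then `T = 0`
     (the multiplier algebra `M(A)` of an essential `*`-algebra is essential).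
(ii) If `A` is semiprime (`a * A * a = 0 → a = 0`) and `T : A → A` is adjointable
     with `T ∘ S ∘ T = 0` for every adjointable `S`, then `T = 0`
     (the multiplier algebra of a semiprime `*`-algebra is semiprime). -/
theorem stmt5 {A : Type*} [NonUnitalRing A] [Module ℂ A] [StarRing A] [StarModule ℂ A]
    [IsScalarTower ℂ A A] [SMulCommClass ℂ A A] :
    ((∀ a : A, (∀ b : A, a * b = 0) → a = 0) →
      ∀ T T' : A → A, (∀ x y : A, star (T x) * y = star x * T' y) →
        (∀ S : A → A, (∃ S' : A → A, ∀ x y : A, star (S x) * y = star x * S' y) →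
          ∀ a : A, T (S a) = 0) →
        T = 0) ∧
    ((∀ a : A, (∀ b : A, a * b * a = 0) → a = 0) →
      ∀ T T' : A → A, (∀ x y : A, star (T x) * y = star x * T' y) →
        (∀ S : A → A, (∃ S' : A → A, ∀ x y : A, star (S x) * y = star x * S' y) →
          ∀ a : A, T (S (T a)) = 0) →
        T = 0) := by
  constructor
  · intro _ T _ _ h
    exact funext fun a => h id ⟨id, fun _ _ => rfl⟩ a
  · intro hA T T' hT h
    have hmul := map_mul_of_adjointable (fun a ha => hA a fun b => by rw [ha, zero_mul]) hT
    refine funext fun a => hA _ fun b => ?_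
    have h' := h (fun x => a * b * x)
      ⟨fun x => star (a * b) * x, fun x y => by rw [star_mul, mul_assoc]⟩ a
    rwa [hmul, hmul] at h'
end

section
/- Let A be an essential *-algebra over ℂ, H a complex Hilbert space, and π : A → B(H) a nondegenerate *-representation; let V := span{π(a)ξ : a ∈ A, ξ ∈ H}, a dense subspace of H. Then there exists a map π̃ assigning to every adjointable T : A → A a linear operator π̃(T) : V → V such that π̃(T)(π(a)ξ) = π(Ta)ξ for all a ∈ A and ξ ∈ H (in particular, this formula is well-defined: Σᵢ π(aᵢ)ξᵢ = Σⱼ π(bⱼ)ηⱼ implies Σᵢ π(Taᵢ)ξᵢ = Σⱼ π(Tbⱼ)ηⱼ). Moreover: each π̃(T) is adjointable as an operator on the inner product space V, with adjoint π̃(T*); π̃ is linear and multiplicative, i.e. π̃(T ∘ S) = π̃(T) ∘ π̃(S); π̃(L_a) is the restriction of π(a) to V; and π̃ is unique: if Ψ assigns to every adjointable T a map Ψ(T) : V → V with Ψ(L_z ∘ T) = Ψ(L_z) ∘ Ψ(T) and Ψ(L_z) = π(z)|_V for all z ∈ A and all adjointable T, then Ψ = π̃. -/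
open scoped ComplexInnerProductSpace

section AdjointableMaps

variable {A : Type*} [NonUnitalRing A] [StarRing A]

/-- If `S` is an adjoint of `T`, then `T` is an adjoint of `S`. -/
theorem adjoint_symm {T S : A → A} (h : ∀ a b : A, star (T a) * b = star a * S b) (a b : A) :
    star (S a) * b = star a * T b := by
  simpa using (congrArg star (h b a)).symm

/-- If `S` is an adjoint of `T`, then `L_z ∘ T` is again a left multiplication. -/
theorem mul_apply_of_adjoint {T S : A → A} (h : ∀ a b : A, star (T a) * b = star a * S b)
    (z b : A) : z * T b = star (S (star z)) * b := by
  rw [adjoint_symm h, star_star]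

end AdjointableMaps

section Representation

variable {A : Type*} [NonUnitalRing A] [Module ℂ A] [StarRing A]
  {H : Type*} [NormedAddCommGroup H] [InnerProductSpace ℂ H] [CompleteSpace H]
  {π : A →⋆ₙₐ[ℂ] (H →L[ℂ] H)} {V : Submodule ℂ H}

theorem inner_map_star_left (π : A →⋆ₙₐ[ℂ] (H →L[ℂ] H)) (a : A) (x y : H) :
    ⟪π (star a) x, y⟫ = ⟪x, π a y⟫ := by
  rw [map_star, ContinuousLinearMap.star_eq_adjoint, ContinuousLinearMap.adjoint_inner_left]

/-- The operators of a nondegenerate representation jointly separate points. -/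
theorem eq_of_forall_map_apply_eq
    (hV : V = Submodule.span ℂ {x : H | ∃ (a : A) (ξ : H), π a ξ = x})
    (hdense : Dense (V : Set H)) {x y : H} (h : ∀ z : A, π z x = π z y) : x = y := by
  refine hdense.eq_of_inner_left ℂ fun v hv => ?_
  rw [SetLike.mem_coe, hV] at hv
  induction hv using Submodule.span_induction with
  | mem v hv =>
    obtain ⟨a, ξ, rfl⟩ := hv
    rw [← inner_map_star_left, ← inner_map_star_left, h]
  | zero => simp
  | add v w _ _ hv hw => rw [inner_add_right, inner_add_right, hv, hw]
  | smul c v _ hv => rw [inner_smul_right, inner_smul_right, hv]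

/-- Every vector of `V` has an image under the extension of the representation to `T`. -/
theorem exists_map_apply_eq
    (hV : V = Submodule.span ℂ {x : H | ∃ (a : A) (ξ : H), π a ξ = x})
    {T S : A → A} (h : ∀ a b : A, star (T a) * b = star a * S b) {v : H} (hv : v ∈ V) :
    ∃ w ∈ V, ∀ z : A, π z w = π (star (S (star z))) v := by
  rw [hV] at hv
  induction hv using Submodule.span_induction with
  | mem v hv =>
    obtain ⟨a, ξ, rfl⟩ := hv
    refine ⟨π (T a) ξ, hV ▸ Submodule.subset_span ⟨T a, ξ, rfl⟩, fun z => ?_⟩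
    rw [← mul_apply_eq_comp, ← mul_apply_eq_comp, ← map_mul, ← map_mul,
      mul_apply_of_adjoint h]
  | zero => exact ⟨0, V.zero_mem, by simp⟩
  | add v v' _ _ hv hv' =>
    obtain ⟨w, hw, e⟩ := hv
    obtain ⟨w', hw', e'⟩ := hv'
    exact ⟨w + w', V.add_mem hw hw', fun z => by rw [map_add, map_add, e, e']⟩
  | smul c v _ hv =>
    obtain ⟨w, hw, e⟩ := hv
    exact ⟨c • w, V.smul_mem c hw, fun z => by rw [map_smul, map_smul, e]⟩

/-- The extension of a nondegenerate representation to a single adjointable map. -/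
theorem exists_linearMap_map_apply_eq
    (hV : V = Submodule.span ℂ {x : H | ∃ (a : A) (ξ : H), π a ξ = x})
    (hdense : Dense (V : Set H))
    {T S : A → A} (h : ∀ a b : A, star (T a) * b = star a * S b) :
    ∃ F : V →ₗ[ℂ] V, ∀ (z : A) (v : V), π z (F v) = π (star (S (star z))) (v : H) := by
  choose f hfV hf using fun v : V => exists_map_apply_eq hV h v.2
  refine ⟨{ toFun := fun v => ⟨f v, hfV v⟩, map_add' := fun v w => ?_,
            map_smul' := fun c v => ?_ }, fun z v => hf v z⟩
  · refine Subtype.ext (eq_of_forall_map_apply_eq hV hdense fun z => ?_)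
    simp [hf]
  · refine Subtype.ext (eq_of_forall_map_apply_eq hV hdense fun z => ?_)
    simp [hf]

end Representation

/-- Let `A` be an essential `*`-algebra over `ℂ`, `H` a complex
Hilbert space and `π : A → B(H)` a nondegenerate `*`-representation; let
`V = span {π(a)ξ}` (a dense subspace of `H`).  Then there is a map `π̃ = Φ`
assigning to every adjointable `T : A → A` a linear operator on `V` with
`π̃(T)(π(a)ξ) = π(T a)ξ` (in particular this formula is well defined).  Moreover
each `π̃(T)` is adjointable on the inner product space `V` with adjoint `π̃(T*)`;
`π̃` is linear and multiplicative; `π̃(L_a)` is the restriction of `π(a)` to `V`;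
and `π̃` is unique among maps `Ψ` with `Ψ(L_z ∘ T) = Ψ(L_z) ∘ Ψ(T)` and
`Ψ(L_z) = π(z)|_V` for all `z ∈ A` and adjointable `T`. -/
theorem stmt7 {A : Type*} [NonUnitalRing A] [Module ℂ A] [StarRing A] [StarModule ℂ A]
    [IsScalarTower ℂ A A] [SMulCommClass ℂ A A]
    {H : Type*} [NormedAddCommGroup H] [InnerProductSpace ℂ H] [CompleteSpace H]
    (hEss : ∀ a : A, (∀ b : A, a * b = 0) → a = 0)
    (π : A →⋆ₙₐ[ℂ] (H →L[ℂ] H))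
    (V : Submodule ℂ H)
    (hV : V = Submodule.span ℂ {x : H | ∃ (a : A) (ξ : H), π a ξ = x})
    (hdense : Dense (V : Set H)) :
    ∃ Φ : (A → A) → (V →ₗ[ℂ] V),
      -- the defining formula on generators (in particular, it is well defined)
      (∀ T : A → A, (∃ S : A → A, ∀ a b : A, star (T a) * b = star a * S b) →
        ∀ (a : A) (ξ : H) (v : V), (v : H) = π a ξ → (Φ T v : H) = π (T a) ξ) ∧
      -- each `π̃(T)` is adjointable on `V`, with adjoint `π̃(T*)`
      (∀ T S : A → A, (∀ a b : A, star (T a) * b = star a * S b) →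
        ∀ v w : V, ⟪(Φ T v : H), (w : H)⟫ = ⟪(v : H), (Φ S w : H)⟫) ∧
      -- `π̃` is additive on adjointable maps
      (∀ T S : A → A, (∃ T' : A → A, ∀ a b : A, star (T a) * b = star a * T' b) →
        (∃ S' : A → A, ∀ a b : A, star (S a) * b = star a * S' b) →
        Φ (T + S) = Φ T + Φ S) ∧
      -- `π̃` is `ℂ`-homogeneous on adjointable maps
      (∀ (c : ℂ) (T : A → A), (∃ T' : A → A, ∀ a b : A, star (T a) * b = star a * T' b) →
        Φ (c • T) = c • Φ T) ∧
      -- `π̃` is multiplicative on adjointable maps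
      (∀ T S : A → A, (∃ T' : A → A, ∀ a b : A, star (T a) * b = star a * T' b) →
        (∃ S' : A → A, ∀ a b : A, star (S a) * b = star a * S' b) →
        Φ (T ∘ S) = (Φ T).comp (Φ S)) ∧
      -- `π̃(L_a)` is the restriction of `π(a)` to `V`
      (∀ (a : A) (v : V), (Φ (fun b => a * b) v : H) = π a (v : H)) ∧
      -- uniqueness
      (∀ Ψ : (A → A) → (V → V),
        (∀ (z : A) (T : A → A), (∃ S : A → A, ∀ a b : A, star (T a) * b = star a * S b) →
          Ψ ((fun b => z * b) ∘ T) = Ψ (fun b => z * b) ∘ Ψ T) →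
        (∀ (z : A) (v : V), (Ψ (fun b => z * b) v : H) = π z (v : H)) →
        ∀ T : A → A, (∃ S : A → A, ∀ a b : A, star (T a) * b = star a * S b) →
          ∀ v : V, Ψ T v = Φ T v) := by
  have key : ∀ T : A → A, ∃ F : V →ₗ[ℂ] V, ∀ S : A → A,
      (∀ a b : A, star (T a) * b = star a * S b) →
      ∀ (z : A) (v : V), π z (F v) = π (star (S (star z))) (v : H) := by
    intro T
    by_cases hT : ∃ S : A → A, ∀ a b : A, star (T a) * b = star a * S b
    · obtain ⟨S, hS⟩ := hT
      obtain ⟨F, hF⟩ := exists_linearMap_map_apply_eq hV hdense hS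
      refine ⟨F, fun S' hS' z v => ?_⟩
      have hSS' : S' = S := funext fun b => sub_eq_zero.mp <| star_eq_zero.mp <|
        hEss _ fun c => by
          rw [star_sub, sub_mul, adjoint_symm hS', adjoint_symm hS, sub_self]
      rw [hSS', hF]
    · exact ⟨0, fun S hS => absurd ⟨S, hS⟩ hT⟩
  choose Φ hΦ using key
  have ext {x y : H} (h : ∀ z : A, π z x = π z y) : x = y :=
    eq_of_forall_map_apply_eq hV hdense h
  have hformula : ∀ T : A → A, (∃ S : A → A, ∀ a b : A, star (T a) * b = star a * S b) →
      ∀ (a : A) (ξ : H) (v : V), (v : H) = π a ξ → (Φ T v : H) = π (T a) ξ := by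
    rintro T ⟨S, hS⟩ a ξ v hv
    refine ext fun z => ?_
    rw [hΦ T S hS, hv, ← mul_apply_eq_comp, ← mul_apply_eq_comp,
      ← map_mul, ← map_mul, mul_apply_of_adjoint hS]
  refine ⟨Φ, hformula, ?_, ?_, ?_, ?_, ?_, ?_⟩
  · intro T S hS v w
    have hspan : V ≤ Submodule.span ℂ {x : H | ∃ (a : A) (ξ : H), π a ξ = x} := hV.le
    have hgen : ∀ (a : A) (ξ : H) (w : V), (w : H) = π a ξ →
        ⟪(Φ T v : H), (w : H)⟫ = ⟪(v : H), (Φ S w : H)⟫ := by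
      intro a ξ w hw
      have hSw : (Φ S w : H) = π (S a) ξ := hformula S ⟨T, adjoint_symm hS⟩ a ξ w hw
      rw [hw, hSw, ← inner_map_star_left, hΦ T S hS, star_star, inner_map_star_left]
    obtain ⟨w, hw⟩ := w
    have hw' := hspan hw
    induction hw' using Submodule.span_induction with
    | mem x hx =>
      obtain ⟨a, ξ, rfl⟩ := hx
      exact hgen a ξ _ rfl
    | zero =>
      rw [show (⟨0, hw⟩ : V) = 0 from rfl]
      simp
    | add x y hx hy ihx ihy =>
      rw [← hV] at hx hy
      rw [show (⟨x + y, hw⟩ : V) = ⟨x, hx⟩ + ⟨y, hy⟩ from rfl, map_add, Submodule.coe_add,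
        Submodule.coe_add, inner_add_right, inner_add_right, ihx hx, ihy hy]
    | smul c x hx ihx =>
      rw [← hV] at hx
      rw [show (⟨c • x, hw⟩ : V) = c • ⟨x, hx⟩ from rfl, map_smul, Submodule.coe_smul,
        Submodule.coe_smul, inner_smul_right, inner_smul_right, ihx hx]
  · rintro T S ⟨T', hT⟩ ⟨S', hS⟩
    have hTS : ∀ a b : A, star ((T + S) a) * b = star a * (T' + S') b := fun a b => by
      simp only [Pi.add_apply, star_add, add_mul, mul_add, hT, hS]
    refine LinearMap.ext fun v => Subtype.ext (ext fun z => ?_)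
    simp [hΦ _ _ hTS, hΦ _ _ hT, hΦ _ _ hS]
  · rintro c T ⟨T', hT⟩
    have hcT : ∀ a b : A, star ((c • T) a) * b = star a * (star c • T') b := fun a b => by
      simp only [Pi.smul_apply, star_smul, smul_mul_assoc, mul_smul_comm, hT]
    refine LinearMap.ext fun v => Subtype.ext (ext fun z => ?_)
    simp [hΦ _ _ hcT, hΦ _ _ hT]
  · rintro T S ⟨T', hT⟩ ⟨S', hS⟩
    have hTS : ∀ a b : A, star ((T ∘ S) a) * b = star a * (S' ∘ T') b := fun a b => by
      simp only [Function.comp_apply, hT, hS]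
    refine LinearMap.ext fun v => Subtype.ext (ext fun z => ?_)
    simp [hΦ _ _ hTS, hΦ _ _ hT, hΦ _ _ hS]
  · intro a v
    have hL : ∀ b c : A, star (a * b) * c = star b * (star a * c) := fun b c => by
      rw [star_mul, mul_assoc]
    refine ext fun z => ?_
    rw [hΦ _ _ hL, ← mul_apply_eq_comp, ← map_mul, ← star_mul, star_star]
  · rintro Ψ hcomp hL T ⟨S, hS⟩ v
    refine Subtype.ext (ext fun z => ?_)
    have hzT : (fun b => z * b) ∘ T = fun b => star (S (star z)) * b :=
      funext fun b => mul_apply_of_adjoint hS z b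
    rw [hΦ T S hS, ← hL, ← hL, ← hzT, hcomp z T ⟨S, hS⟩, Function.comp_apply]
end

section
/- Let G be a group acting on the right on a set X, Γ a subgroup of G, and set Γ^g := Γ ∩ gΓg⁻¹. For w, v ∈ G, θ ∈ Γ and y ∈ X, the numbers n^y_{w,v} and d^y_{w,v} satisfy: (i) n^y_{w,vθ} = n^y_{w,v} and d^y_{w,vθ} = d^y_{w,v}; (ii) n^y_{θw,v} = n^y_{w,v} and d^y_{θw,v} = d^y_{w,v}; (iii) n^{yθ}_{w,θ⁻¹v} = n^y_{wθ⁻¹,v} and d^{yθ}_{w,θ⁻¹v} = d^y_{wθ⁻¹,v}. -/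
/-- The subgroup `Γ^g := Γ ∩ gΓg⁻¹` of `G`. -/
def conjInter {G : Type*} [Group G] (Γ : Subgroup G) (g : G) : Subgroup G :=
  Γ ⊓ Subgroup.map (MulAut.conj g).toMonoidHom Γ

/-- The set of left cosets
`𝔫^y_{w,v} = {rΓ ∈ ΓwΓ/Γ : r⁻¹wvΓ ⊆ ΓvΓ and y·w⁻¹ ∈ y·Γr⁻¹}`,
realized as a set of subsets of `G` (each left coset `rΓ` being a subset of `G`). -/
def heckeN {G X : Type*} [Group G] (act : X → G → X) (Γ : Subgroup G)
    (y : X) (w v : G) : Set (Set G) :=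
  {R : Set G | ∃ r : G,
    R = {g : G | ∃ γ ∈ Γ, g = r * γ} ∧
    (∃ γ₁ ∈ Γ, ∃ γ₂ ∈ Γ, r = γ₁ * w * γ₂) ∧
    (∀ γ ∈ Γ, ∃ γ₁ ∈ Γ, ∃ γ₂ ∈ Γ, r⁻¹ * w * v * γ = γ₁ * v * γ₂) ∧
    (∃ γ ∈ Γ, act y w⁻¹ = act y (γ * r⁻¹))}

/-- The set of left cosets
`𝔡^y_{w,v} = {rΓ ∈ ΓwΓ/Γ : r⁻¹wvΓ ⊆ ΓvΓ and y·w⁻¹ ∈ y·Γr⁻¹Γ^{wv}}`. -/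
def heckeD {G X : Type*} [Group G] (act : X → G → X) (Γ : Subgroup G)
    (y : X) (w v : G) : Set (Set G) :=
  {R : Set G | ∃ r : G,
    R = {g : G | ∃ γ ∈ Γ, g = r * γ} ∧
    (∃ γ₁ ∈ Γ, ∃ γ₂ ∈ Γ, r = γ₁ * w * γ₂) ∧
    (∀ γ ∈ Γ, ∃ γ₁ ∈ Γ, ∃ γ₂ ∈ Γ, r⁻¹ * w * v * γ = γ₁ * v * γ₂) ∧
    (∃ γ ∈ Γ, ∃ θ ∈ conjInter Γ (w * v), act y w⁻¹ = act y (γ * r⁻¹ * θ))}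

theorem mem_conjInter {G : Type*} [Group G] {Γ : Subgroup G} {g x : G} :
    x ∈ conjInter Γ g ↔ x ∈ Γ ∧ g⁻¹ * x * g ∈ Γ := by
  refine and_congr_right fun _ => ⟨?_, fun h => ⟨_, h, ?_⟩⟩
  · rintro ⟨z, hz, rfl⟩
    simpa [mul_assoc] using hz
  · simp [mul_assoc]

theorem conjInter_mul_right {G : Type*} [Group G] (Γ : Subgroup G) (g : G) {θ : G}
    (hθ : θ ∈ Γ) : conjInter Γ (g * θ) = conjInter Γ g := by
  ext x
  have h : (g * θ)⁻¹ * x * (g * θ) = θ⁻¹ * (g⁻¹ * x * g) * θ := by group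
  rw [mem_conjInter, mem_conjInter, h, Γ.mul_mem_cancel_right hθ,
    Γ.mul_mem_cancel_left (Γ.inv_mem hθ)]

theorem conjInter_mul_left {G : Type*} [Group G] (Γ : Subgroup G) (g : G) {θ : G}
    (hθ : θ ∈ Γ) :
    conjInter Γ (θ * g) = (conjInter Γ g).map (MulAut.conj θ).toMonoidHom := by
  ext x
  rw [mem_conjInter]
  constructor
  · rintro ⟨hx, hgx⟩
    refine ⟨θ⁻¹ * x * θ, mem_conjInter.2
      ⟨Γ.mul_mem (Γ.mul_mem (Γ.inv_mem hθ) hx) hθ, ?_⟩, ?_⟩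
    · simpa [mul_assoc] using hgx
    · simp [mul_assoc]
  · rintro ⟨z, hz, rfl⟩
    obtain ⟨hz, hgz⟩ := mem_conjInter.1 hz
    refine ⟨Γ.mul_mem (Γ.mul_mem hθ hz) (Γ.inv_mem hθ), ?_⟩
    simpa [mul_assoc] using hgz

/-- The common generalization of `heckeN` and `heckeD`: the set of left cosets
`{rΓ ∈ ΓwΓ/Γ : r⁻¹wvΓ ⊆ ΓvΓ and y·w⁻¹ ∈ y·Γr⁻¹H}` for a subgroup `H` of `G`. -/
def heckeCosets {G X : Type*} [Group G] (act : X → G → X) (Γ H : Subgroup G)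
    (y : X) (w v : G) : Set (Set G) :=
  {R : Set G | ∃ r : G,
    R = {g : G | ∃ γ ∈ Γ, g = r * γ} ∧
    (∃ γ₁ ∈ Γ, ∃ γ₂ ∈ Γ, r = γ₁ * w * γ₂) ∧
    (∀ γ ∈ Γ, ∃ γ₁ ∈ Γ, ∃ γ₂ ∈ Γ, r⁻¹ * w * v * γ = γ₁ * v * γ₂) ∧
    (∃ γ ∈ Γ, ∃ η ∈ H, act y w⁻¹ = act y (γ * r⁻¹ * η))}

section

variable {G X : Type*} [Group G] (act : X → G → X) (Γ H : Subgroup G) (y : X) (w v : G)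

theorem heckeN_eq_heckeCosets : heckeN act Γ y w v = heckeCosets act Γ ⊥ y w v := by
  simp [heckeN, heckeCosets]

theorem heckeD_eq_heckeCosets :
    heckeD act Γ y w v = heckeCosets act Γ (conjInter Γ (w * v)) y w v :=
  rfl

variable {Γ} {θ : G}

theorem heckeCosets_mul_right (hθ : θ ∈ Γ) :
    heckeCosets act Γ H y w (v * θ) = heckeCosets act Γ H y w v := by
  have key : ∀ (v : G) {θ : G}, θ ∈ Γ →
      heckeCosets act Γ H y w v ⊆ heckeCosets act Γ H y w (v * θ) := by
    rintro v θ hθ R ⟨r, hR, hr, hv, hy⟩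
    refine ⟨r, hR, hr, fun γ hγ => ?_, hy⟩
    obtain ⟨a, ha, b, hb, hab⟩ := hv (θ * γ) (Γ.mul_mem hθ hγ)
    refine ⟨a, ha, θ⁻¹ * b, Γ.mul_mem (Γ.inv_mem hθ) hb, ?_⟩
    simpa [mul_assoc] using hab
  refine (key v hθ).antisymm' ?_
  simpa using key (v * θ) (Γ.inv_mem hθ)

open scoped Pointwise in
theorem heckeCosets_mul_left
    (h_mul : ∀ (x : X) (g₁ g₂ : G), act x (g₁ * g₂) = act (act x g₁) g₂) (hθ : θ ∈ Γ) :
    heckeCosets act Γ (H.map (MulAut.conj θ).toMonoidHom) y (θ * w) v =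
      θ • heckeCosets act Γ H y w v := by
  have key : ∀ (H : Subgroup G) (w : G) {θ : G}, θ ∈ Γ → θ • heckeCosets act Γ H y w v ⊆
      heckeCosets act Γ (H.map (MulAut.conj θ).toMonoidHom) y (θ * w) v := by
    rintro H w θ hθ _ ⟨_, ⟨r, rfl, ⟨a, ha, b, hb, rfl⟩, hv, γ, hγ, η, hη, hy⟩, rfl⟩
    refine ⟨θ * (a * w * b), ?_, ⟨θ * a * θ⁻¹,
      Γ.mul_mem (Γ.mul_mem hθ ha) (Γ.inv_mem hθ), b, hb, by simp [mul_assoc]⟩,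
      fun γ hγ => ?_, γ, hγ, θ * η * θ⁻¹, ⟨η, hη, rfl⟩, ?_⟩
    · ext g
      simp only [Set.mem_smul_set_iff_inv_smul_mem, Set.mem_ofPred_eq, smul_eq_mul,
        inv_mul_eq_iff_eq_mul, mul_assoc]
    · simpa [mul_assoc] using hv γ hγ
    · have h := congrArg (act · θ⁻¹) hy
      simp only [← h_mul] at h
      simpa [mul_assoc] using h
  refine (key H w hθ).antisymm' (Set.subset_smul_set_iff.2 ?_)
  have h := key (H.map (MulAut.conj θ).toMonoidHom) (θ * w) (Γ.inv_mem hθ)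
  have hH : (H.map (MulAut.conj θ).toMonoidHom).map (MulAut.conj θ⁻¹).toMonoidHom = H := by
    ext x
    simp [mul_assoc]
  rwa [hH, inv_mul_cancel_left] at h

open scoped Pointwise in
theorem ncard_heckeCosets_mul_left
    (h_mul : ∀ (x : X) (g₁ g₂ : G), act x (g₁ * g₂) = act (act x g₁) g₂) (hθ : θ ∈ Γ) :
    (heckeCosets act Γ (H.map (MulAut.conj θ).toMonoidHom) y (θ * w) v).ncard =
      (heckeCosets act Γ H y w v).ncard := by
  rw [heckeCosets_mul_left act H y w v h_mul hθ, Set.ncard_smul_set]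

theorem heckeCosets_act
    (h_mul : ∀ (x : X) (g₁ g₂ : G), act x (g₁ * g₂) = act (act x g₁) g₂) (hθ : θ ∈ Γ) :
    heckeCosets act Γ H (act y θ) w (θ⁻¹ * v) = heckeCosets act Γ H y (w * θ⁻¹) v := by
  have hθ' := Γ.inv_mem hθ
  ext R
  refine exists_congr fun r => and_congr_right fun _ => and_congr ?_ (and_congr ?_ ?_)
  · constructor
    · rintro ⟨a, ha, b, hb, rfl⟩
      exact ⟨a, ha, θ * b, Γ.mul_mem hθ hb, by simp [mul_assoc]⟩
    · rintro ⟨a, ha, b, hb, rfl⟩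
      exact ⟨a, ha, θ⁻¹ * b, Γ.mul_mem hθ' hb, by simp [mul_assoc]⟩
  · refine forall₂_congr fun γ _ => ⟨?_, ?_⟩
    · rintro ⟨a, ha, b, hb, h⟩
      exact ⟨a * θ⁻¹, Γ.mul_mem ha hθ', b, hb, by simpa [mul_assoc] using h⟩
    · rintro ⟨a, ha, b, hb, h⟩
      exact ⟨a * θ, Γ.mul_mem ha hθ, b, hb, by simpa [mul_assoc] using h⟩
  · simp only [← h_mul, mul_inv_rev, inv_inv]
    constructor
    · rintro ⟨γ, hγ, η, hη, h⟩
      exact ⟨θ * γ, Γ.mul_mem hθ hγ, η, hη, by simpa [mul_assoc] using h⟩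
    · rintro ⟨γ, hγ, η, hη, h⟩
      exact ⟨θ⁻¹ * γ, Γ.mul_mem hθ' hγ, η, hη, by simpa [mul_assoc] using h⟩

end

/-- Invariance properties of the numbers `n^y_{w,v}` and `d^y_{w,v}`:
for `θ ∈ Γ`,
(i)   `n^y_{w,vθ} = n^y_{w,v}` and `d^y_{w,vθ} = d^y_{w,v}`;
(ii)  `n^y_{θw,v} = n^y_{w,v}` and `d^y_{θw,v} = d^y_{w,v}`;
(iii) `n^{yθ}_{w,θ⁻¹v} = n^y_{wθ⁻¹,v}` and `d^{yθ}_{w,θ⁻¹v} = d^y_{wθ⁻¹,v}`. -/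
theorem stmt10 {G X : Type*} [Group G] (act : X → G → X)
    (h_one : ∀ x : X, act x 1 = x)
    (h_mul : ∀ (x : X) (g₁ g₂ : G), act x (g₁ * g₂) = act (act x g₁) g₂)
    (Γ : Subgroup G) (w v : G) (θ : G) (hθ : θ ∈ Γ) (y : X) :
    ((heckeN act Γ y w (v * θ)).ncard = (heckeN act Γ y w v).ncard ∧
      (heckeD act Γ y w (v * θ)).ncard = (heckeD act Γ y w v).ncard) ∧
    ((heckeN act Γ y (θ * w) v).ncard = (heckeN act Γ y w v).ncard ∧
      (heckeD act Γ y (θ * w) v).ncard = (heckeD act Γ y w v).ncard) ∧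
    ((heckeN act Γ (act y θ) w (θ⁻¹ * v)).ncard = (heckeN act Γ y (w * θ⁻¹) v).ncard ∧
      (heckeD act Γ (act y θ) w (θ⁻¹ * v)).ncard = (heckeD act Γ y (w * θ⁻¹) v).ncard) := by
  refine ⟨⟨?_, ?_⟩, ⟨?_, ?_⟩, ?_, ?_⟩
  · simp only [heckeN_eq_heckeCosets, heckeCosets_mul_right act _ _ _ _ hθ]
  · simp only [heckeD_eq_heckeCosets, ← mul_assoc, conjInter_mul_right Γ _ hθ,
      heckeCosets_mul_right act _ _ _ _ hθ]
  · have h := ncard_heckeCosets_mul_left act ⊥ y w v h_mul hθ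
    rw [Subgroup.map_bot] at h
    rw [heckeN_eq_heckeCosets, heckeN_eq_heckeCosets, h]
  · rw [heckeD_eq_heckeCosets, heckeD_eq_heckeCosets, mul_assoc, conjInter_mul_left Γ _ hθ,
      ncard_heckeCosets_mul_left act _ y w v h_mul hθ]
  · simp only [heckeN_eq_heckeCosets, heckeCosets_act act _ _ _ _ h_mul hθ]
  · simp only [heckeD_eq_heckeCosets, heckeCosets_act act _ _ _ _ h_mul hθ, mul_assoc]
end
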